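/- Let a ≥ l ≥ 1 and k ≥ 0 be integers, and let i₁ < i₂ < ⋯ < i_k be indices in {1,…,l−1} satisfying i_{j+1} ≥ i_j + 2 for all j. Define the superpartition Λ = (Λᵃ; Λˢ) as follows: Λᵃ consists of the values a−l+j−1 for those j ∈ {1,…,l} not belonging to ⋃_{m=1}^{k} {i_m, i_m + 1} (arranged strictly decreasingly), and Λˢ consists of each value a−l+i_m (for m = 1,…,k) taken with multiplicity two (arranged weakly decreasingly). Let Λ* be the weakly decreasing rearrangement of all l parts of Λᵃ and Λˢ together, and let Λ^⊛ be the weakly decreasing rearrangement of the parts {x+1 : x ∈ Λᵃ} together with the parts of Λˢ. Then Λ is (2,2,l)-admissible: Λ^⊛_i − Λ*_{i+2} ≥ 2 for all 1 ≤ i ≤ l−2. -/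

import Mathlib

/-- The `n`-th largest element of the multiset of values of a monotone function on `1, …, l`. -/
theorem getD_reverse_sort_map_Icc {g : ℕ → ℕ} (hg : Monotone g) {l n : ℕ} (hn : n < l) :
    ((((Finset.Icc 1 l).val.map g).sort (· ≤ ·)).reverse).getD n 0 = g (l - n) := by
  have hcoe : (Finset.Icc 1 l).val.map g = (((List.range' 1 l).map g : List ℕ) : Multiset ℕ) := by
    rfl
  have hsorted : ((List.range' 1 l).map g).Pairwise (· ≤ ·) := by
    rw [List.pairwise_map]
    exact (List.pairwise_lt_range' (s := 1) (n := l)).imp fun h => hg h.le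
  have hsort : ((Finset.Icc 1 l).val.map g).sort (· ≤ ·) = (List.range' 1 l).map g := by
    refine List.Perm.eq_of_pairwise (fun _ _ _ _ => le_antisymm)
      (Multiset.pairwise_sort _ _) hsorted ?_
    rw [← Multiset.coe_eq_coe, Multiset.sort_eq, hcoe]
  rw [hsort, List.getD_eq_getElem _ _ (by simpa using hn)]
  simp only [List.getElem_reverse, List.length_map, List.length_range', List.getElem_map,
    List.getElem_range']
  congr 1
  omega

/-- The values of `F` on a finite set containing the disjoint pairs `{ι m, ι m + 1}`, split into
the values off these pairs and the values on them. -/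
theorem map_sdiff_pairs_add_bind {β : Type*} {k : ℕ} {ι : Fin k → ℕ} {s : Finset ℕ}
    (hs : ∀ m, ι m ∈ s ∧ ι m + 1 ∈ s)
    (hgap : ∀ m n : Fin k, m < n → ι m + 2 ≤ ι n) (F : ℕ → β) :
    (s \ (Finset.image ι Finset.univ ∪
        Finset.image (fun m => ι m + 1) Finset.univ)).val.map F +
      (Finset.univ.val : Multiset (Fin k)).bind (fun m => {F (ι m)} + {F (ι m + 1)}) =
    s.val.map F := by
  have hinj : Function.Injective ι :=
    StrictMono.injective fun m n h => by have := hgap m n h; omega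
  have hinj' : Function.Injective fun m => ι m + 1 := fun m n h => hinj (Nat.succ_injective h)
  have hdisj : Disjoint (Finset.image ι Finset.univ)
      (Finset.image (fun m => ι m + 1) Finset.univ) := by
    simp only [Finset.disjoint_left, Finset.mem_image, Finset.mem_univ, true_and]
    rintro _ ⟨m, rfl⟩ ⟨n, hn⟩
    rcases lt_trichotomy m n with h | rfl | h
    · have := hgap m n h; omega
    · omega
    · have := hgap n m h; omega
  have hsub : Finset.image ι Finset.univ ∪ Finset.image (fun m => ι m + 1) Finset.univ ⊆ s := by
    simp only [Finset.union_subset_iff, Finset.image_subset_iff, Finset.mem_univ, true_imp_iff]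
    exact ⟨fun m => (hs m).1, fun m => (hs m).2⟩
  have hpairs : (Finset.image ι Finset.univ ∪ Finset.image (fun m => ι m + 1) Finset.univ).val =
      Finset.univ.val.map ι + Finset.univ.val.map (fun m => ι m + 1) := by
    rw [← Finset.disjUnion_eq_union _ _ hdisj, Finset.disjUnion_val,
      Finset.image_val_of_injOn hinj.injOn, Finset.image_val_of_injOn hinj'.injOn]
  have hsplit := tsub_add_cancel_of_le (Finset.val_le_iff.mpr hsub)
  rw [← Finset.sdiff_val] at hsplit
  rw [← hsplit, Multiset.map_add, hpairs, Multiset.map_add, Multiset.map_map, Multiset.map_map,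
    Multiset.bind_add, Multiset.bind_singleton, Multiset.bind_singleton]
  rfl

open Finset in
/-- Admissibility of the superpartitions in `𝒳_k(Γ̄)`: for `a ≥ l ≥ 1` and indices
`i₁ < ⋯ < i_k` in `{1,…,l−1}` with `i_{j+1} ≥ i_j + 2`, let `Λᵃ` consist of the values
`a−l+j−1` for `j ∈ {1,…,l} ∖ ⋃ₘ {iₘ, iₘ+1}`, and let `Λˢ` consist of each value
`a−l+iₘ` with multiplicity two.  Let `Λ*` be the decreasing rearrangement of all `l`
parts, and `Λ^⊛` the decreasing rearrangement of `{x+1 : x ∈ Λᵃ} ∪ Λˢ`.  Then `Λ` is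
`(2,2,l)`-admissible: `Λ^⊛ᵢ − Λ*_{i+2} ≥ 2` for `1 ≤ i ≤ l−2`. -/
theorem admissibility_of_X_k (a l k : ℕ) (hl : 1 ≤ l) (ha : l ≤ a)
    (ι : Fin k → ℕ)
    (hrange : ∀ m, 1 ≤ ι m ∧ ι m ≤ l - 1)
    (hgap : ∀ m n : Fin k, m < n → ι m + 2 ≤ ι n) :
    ∀ i : ℕ, 1 ≤ i → i ≤ l - 2 →
      (let idx : Finset ℕ :=
        Finset.image ι Finset.univ ∪ Finset.image (fun m => ι m + 1) Finset.univ
      let Λa : Multiset ℕ := (Finset.Icc 1 l \ idx).val.map fun j => a - l + j - 1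
      let Λs : Multiset ℕ :=
        (Finset.univ.val : Multiset (Fin k)).bind fun m => Multiset.replicate 2 (a - l + ι m)
      let Λstar : List ℕ := ((Λa + Λs).sort (· ≤ ·)).reverse
      let Λcirc : List ℕ := ((Λa.map (· + 1) + Λs).sort (· ≤ ·)).reverse
      2 ≤ Λcirc.getD (i - 1) 0 - Λstar.getD (i + 1) 0) := by
  intro i hi hil idx Λa Λs Λstar Λcirc
  classical
  have hs : ∀ m, ι m ∈ Finset.Icc 1 l ∧ ι m + 1 ∈ Finset.Icc 1 l := fun m => by
    have := hrange m
    simp only [Finset.mem_Icc]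
    omega
  have hne : ∀ m n, ι m ≠ ι n + 1 := fun m n hmn => by
    rcases lt_trichotomy m n with h | rfl | h
    · have := hgap m n h; omega
    · omega
    · have := hgap n m h; omega
  let F : ℕ → ℕ := fun j => if ∃ m, ι m = j then a - l + j else a - l + j - 1
  let G : ℕ → ℕ := fun j => if ∃ m, ι m + 1 = j then a - l + j - 1 else a - l + j
  have hF : Monotone F := monotone_nat_of_le_succ fun n => by
    simp only [F]
    split_ifs <;> omega
  have hG : Monotone G := monotone_nat_of_le_succ fun n => by
    simp only [G]
    split_ifs <;> omega
  have hnot : ∀ j ∈ (Finset.Icc 1 l \ idx).val,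
      1 ≤ j ∧ (¬ ∃ m, ι m = j) ∧ ¬ ∃ m, ι m + 1 = j := fun j hj => by
    obtain ⟨h₁, h₂⟩ := Finset.mem_sdiff.mp (Finset.mem_val.mp hj)
    refine ⟨(Finset.mem_Icc.mp h₁).1, ?_⟩
    simpa only [idx, Finset.mem_union, Finset.mem_image, Finset.mem_univ, true_and, not_or]
      using h₂
  have hstar : Λa + Λs = (Finset.Icc 1 l).val.map F := by
    rw [← map_sdiff_pairs_add_bind hs hgap F]
    congr 1
    · exact Multiset.map_congr rfl fun j hj => by simp [F, (hnot j hj).2.1]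
    · refine Multiset.bind_congr fun m _ => ?_
      have h₁ : F (ι m) = a - l + ι m := if_pos ⟨m, rfl⟩
      have h₂ : F (ι m + 1) = a - l + ι m := if_neg fun ⟨n, hn⟩ => hne n m hn
      rw [h₁, h₂]
      rfl
  have hcirc : Λa.map (· + 1) + Λs = (Finset.Icc 1 l).val.map G := by
    rw [← map_sdiff_pairs_add_bind hs hgap G, Multiset.map_map]
    congr 1
    · refine Multiset.map_congr rfl fun j hj => ?_
      have h₁ : G j = a - l + j := if_neg (hnot j hj).2.2
      have h₂ := (hnot j hj).1
      simp only [Function.comp_apply, h₁]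
      omega
    · refine Multiset.bind_congr fun m _ => ?_
      have h₁ : G (ι m) = a - l + ι m := if_neg fun ⟨n, hn⟩ => hne m n hn.symm
      have h₂ : G (ι m + 1) = a - l + ι m := if_pos ⟨m, rfl⟩
      rw [h₁, h₂]
      rfl
  simp only [Λstar, Λcirc, hstar, hcirc]
  rw [getD_reverse_sort_map_Icc hF (by omega), getD_reverse_sort_map_Icc hG (by omega)]
  obtain ⟨j, hj⟩ : ∃ j, l = i + 1 + (j + 1) := ⟨l - i - 2, by omega⟩
  rw [show l - (i + 1) = j + 1 by omega, show l - (i - 1) = j + 3 by omega]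
  simp only [F, G]
  split_ifs with h₁ h₂ h₂
  · obtain ⟨m, hm⟩ := h₁
    obtain ⟨n, hn⟩ := h₂
    exact absurd (show ι m = ι n + 1 by omega) (hne m n)
  all_goals omega
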